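/- Let p, q > 0 with p + q ≤ 1, and let X be a fixed n×n complex matrix. Then the function (A,B) ↦ Trace(A^q X* B^p X) is jointly concave on pairs of positive definite n×n complex matrices: if A₁, A₂, B₁, B₂ are positive definite and 0 ≤ c ≤ 1, then Trace((cA₁+(1-c)A₂)^q X* (cB₁+(1-c)B₂)^p X) ≥ c·Trace(A₁^q X* B₁^p X) + (1-c)·Trace(A₂^q X* B₂^p X). -/

import Mathlib

open Matrix
open scoped ComplexOrder

/-- The real power `A ^ s` of a matrix, via the continuous functional calculus. -/
noncomputable def matrixRpow {k : ℕ} (A : Matrix (Fin k) (Fin k) ℂ) (s : ℝ) :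
    Matrix (Fin k) (Fin k) ℂ :=
  cfc (fun x : ℝ => x ^ s) A

open Real Set MeasureTheory
open scoped MatrixOrder Matrix.Norms.L2Operator

namespace Lieb

variable {n : ℕ}

/-- The matrix `V* X U`, where `U` and `V` are the eigenvector unitaries of `A` and `B`. -/
noncomputable def eigenbasisChange {A B : Matrix (Fin n) (Fin n) ℂ} (hA : A.IsHermitian)
    (hB : B.IsHermitian) (X : Matrix (Fin n) (Fin n) ℂ) : Matrix (Fin n) (Fin n) ℂ :=
  star (hB.eigenvectorUnitary : Matrix (Fin n) (Fin n) ℂ) * X *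
    (hA.eigenvectorUnitary : Matrix (Fin n) (Fin n) ℂ)

theorem eigenbasisChange_add {A B : Matrix (Fin n) (Fin n) ℂ} (hA : A.IsHermitian)
    (hB : B.IsHermitian) (Y Z : Matrix (Fin n) (Fin n) ℂ) :
    eigenbasisChange hA hB (Y + Z) = eigenbasisChange hA hB Y + eigenbasisChange hA hB Z := by
  simp [eigenbasisChange, mul_add, add_mul]

theorem eigenbasisChange_surjective {A B : Matrix (Fin n) (Fin n) ℂ} (hA : A.IsHermitian)
    (hB : B.IsHermitian) : Function.Surjective (eigenbasisChange hA hB) := by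
  intro W
  refine ⟨(hB.eigenvectorUnitary : Matrix (Fin n) (Fin n) ℂ) * W *
    star (hA.eigenvectorUnitary : Matrix (Fin n) (Fin n) ℂ), ?_⟩
  have h₁ := Unitary.coe_star_mul_self hB.eigenvectorUnitary
  have h₂ := Unitary.coe_star_mul_self hA.eigenvectorUnitary
  simp only [eigenbasisChange, ← mul_assoc, h₁, one_mul]
  rw [mul_assoc, h₂, mul_one]

/-- The trace pairing of functions of `A` and `B`, computed in eigenbases. -/
theorem re_trace_cfc_mul {A B : Matrix (Fin n) (Fin n) ℂ} (hA : A.IsHermitian)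
    (hB : B.IsHermitian) (X : Matrix (Fin n) (Fin n) ℂ) (f g : ℝ → ℝ) :
    ((cfc f A * Xᴴ * cfc g B * X).trace).re =
      ∑ i, ∑ j, f (hA.eigenvalues j) * g (hB.eigenvalues i) *
        Complex.normSq (eigenbasisChange hA hB X i j) := by
  set U := (hA.eigenvectorUnitary : Matrix (Fin n) (Fin n) ℂ) with hU
  set V := (hB.eigenvectorUnitary : Matrix (Fin n) (Fin n) ℂ) with hV
  set W := eigenbasisChange hA hB X with hW
  have hWs : Wᴴ = star U * Xᴴ * V := by
    simp [hW, eigenbasisChange, conjTranspose_mul, star_eq_conjTranspose, mul_assoc, hU, hV]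
  set D := diagonal (fun j => ((f (hA.eigenvalues j) : ℝ) : ℂ))
  set E := diagonal (fun i => ((g (hB.eigenvalues i) : ℝ) : ℂ))
  have hf : cfc f A = U * D * star U := by
    rw [hA.cfc_eq, IsHermitian.cfc, Unitary.conjStarAlgAut_apply]; rfl
  have hg : cfc g B = V * E * star V := by
    rw [hB.cfc_eq, IsHermitian.cfc, Unitary.conjStarAlgAut_apply]; rfl
  have key : (cfc f A * Xᴴ * cfc g B * X).trace = (D * Wᴴ * E * W).trace := by
    rw [hf, hg, hWs]
    calc _ = (U * (D * star U * Xᴴ * V * E * star V * X)).trace := by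
          simp only [mul_assoc]
      _ = (D * star U * Xᴴ * V * E * star V * X * U).trace := trace_mul_comm _ _
      _ = _ := by simp only [mul_assoc, hW, eigenbasisChange, hU, hV]
  rw [key, Matrix.trace, Complex.re_sum, Finset.sum_comm]
  refine Finset.sum_congr rfl fun j _ => ?_
  rw [diag_apply, Matrix.mul_apply, Complex.re_sum]
  refine Finset.sum_congr rfl fun i _ => ?_
  rw [mul_diagonal, diagonal_mul, conjTranspose_apply, Complex.normSq_apply]
  simp
  ring

/-- The quadratic form in `X` of the parallel sum of left multiplication by `B` and `t` times
right multiplication by `A`. -/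
noncomputable def parallelForm {A B : Matrix (Fin n) (Fin n) ℂ} (hA : A.IsHermitian)
    (hB : B.IsHermitian) (X : Matrix (Fin n) (Fin n) ℂ) (t : ℝ) : ℝ :=
  ∑ i, ∑ j, t * hA.eigenvalues j * hB.eigenvalues i /
    (t * hA.eigenvalues j + hB.eigenvalues i) * Complex.normSq (eigenbasisChange hA hB X i j)

/-- The form minimised over decompositions `X = Y + Z` to obtain `parallelForm`. -/
noncomputable def splitForm (A B Y Z : Matrix (Fin n) (Fin n) ℂ) (t : ℝ) : ℝ :=
  ((Yᴴ * B * Y).trace).re + t * ((A * Zᴴ * Z).trace).re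

theorem splitForm_eq_sum {A B : Matrix (Fin n) (Fin n) ℂ} (hA : A.IsHermitian)
    (hB : B.IsHermitian) (Y Z : Matrix (Fin n) (Fin n) ℂ) (t : ℝ) :
    splitForm A B Y Z t = ∑ i, ∑ j,
      (hB.eigenvalues i * Complex.normSq (eigenbasisChange hA hB Y i j) +
        t * hA.eigenvalues j * Complex.normSq (eigenbasisChange hA hB Z i j)) := by
  have h₁ := re_trace_cfc_mul hA hB Y (fun _ => 1) (fun x => x)
  have h₂ := re_trace_cfc_mul hA hB Z (fun x => x) (fun _ => 1)
  rw [cfc_const_one ℝ A hA.isSelfAdjoint, cfc_id' ℝ B hB.isSelfAdjoint, one_mul] at h₁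
  rw [cfc_const_one ℝ B hB.isSelfAdjoint, cfc_id' ℝ A hA.isSelfAdjoint, mul_one] at h₂
  simp only [splitForm, h₁, h₂, Finset.mul_sum, ← Finset.sum_add_distrib]
  simp only [one_mul, mul_one, mul_assoc]

theorem splitForm_convexCombination (A₁ A₂ B₁ B₂ Y Z : Matrix (Fin n) (Fin n) ℂ) (t c : ℝ) :
    splitForm (c • A₁ + (1 - c) • A₂) (c • B₁ + (1 - c) • B₂) Y Z t =
      c * splitForm A₁ B₁ Y Z t + (1 - c) * splitForm A₂ B₂ Y Z t := by
  simp only [splitForm, mul_add, add_mul, Matrix.mul_smul, Matrix.smul_mul, trace_add,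
    trace_smul, Complex.add_re, Complex.smul_re, smul_eq_mul]
  ring

theorem div_add_mul_normSq_add_le {α β : ℝ} (hα : 0 < α) (hβ : 0 < β) (y z : ℂ) :
    α * β / (α + β) * Complex.normSq (y + z) ≤
      β * Complex.normSq y + α * Complex.normSq z := by
  rw [div_mul_eq_mul_div, div_le_iff₀ (by positivity)]
  simp only [Complex.normSq_apply, Complex.add_re, Complex.add_im]
  nlinarith [sq_nonneg (β * y.re - α * z.re), sq_nonneg (β * y.im - α * z.im)]

theorem parallelForm_le_splitForm {A B : Matrix (Fin n) (Fin n) ℂ} (hA : A.PosDef)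
    (hB : B.PosDef) (Y Z : Matrix (Fin n) (Fin n) ℂ) {t : ℝ} (ht : 0 < t) :
    parallelForm hA.isHermitian hB.isHermitian (Y + Z) t ≤ splitForm A B Y Z t := by
  rw [parallelForm, splitForm_eq_sum hA.isHermitian hB.isHermitian, eigenbasisChange_add]
  gcongr with i _ j _
  exact div_add_mul_normSq_add_le (mul_pos ht (hA.eigenvalues_pos j)) (hB.eigenvalues_pos i) _ _

theorem exists_splitForm_eq_parallelForm {A B : Matrix (Fin n) (Fin n) ℂ} (hA : A.PosDef)
    (hB : B.PosDef) (X : Matrix (Fin n) (Fin n) ℂ) {t : ℝ} (ht : 0 < t) :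
    ∃ Y Z, Y + Z = X ∧
      splitForm A B Y Z t = parallelForm hA.isHermitian hB.isHermitian X t := by
  set a := hA.isHermitian.eigenvalues
  set b := hB.isHermitian.eigenvalues
  set W := eigenbasisChange hA.isHermitian hB.isHermitian X with hW
  obtain ⟨Y, hY⟩ := eigenbasisChange_surjective hA.isHermitian hB.isHermitian
    (Matrix.of fun i j => ((t * a j / (t * a j + b i) : ℝ) : ℂ) * W i j)
  have hZ : ∀ i j, eigenbasisChange hA.isHermitian hB.isHermitian (X - Y) i j =
      ((b i / (t * a j + b i) : ℝ) : ℂ) * W i j := by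
    intro i j
    have hne : t * a j + b i ≠ 0 :=
      (add_pos (mul_pos ht (hA.eigenvalues_pos j)) (hB.eigenvalues_pos i)).ne'
    have h := congrFun (congrFun
      (eigenbasisChange_add hA.isHermitian hB.isHermitian Y (X - Y)) i) j
    rw [add_sub_cancel, ← hW, Matrix.add_apply, hY, of_apply] at h
    have hs : ((t * a j / (t * a j + b i) : ℝ) : ℂ) + ((b i / (t * a j + b i) : ℝ) : ℂ) = 1 := by
      rw [← Complex.ofReal_add, ← add_div, div_self hne, Complex.ofReal_one]
    linear_combination -h - W i j * hs
  refine ⟨Y, X - Y, add_sub_cancel _ _, ?_⟩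
  rw [splitForm_eq_sum hA.isHermitian hB.isHermitian, parallelForm]
  refine Finset.sum_congr rfl fun i _ => Finset.sum_congr rfl fun j _ => ?_
  have hne : t * a j + b i ≠ 0 :=
    (add_pos (mul_pos ht (hA.eigenvalues_pos j)) (hB.eigenvalues_pos i)).ne'
  rw [hZ, hY, of_apply, Complex.normSq_mul, Complex.normSq_mul, Complex.normSq_ofReal,
    Complex.normSq_ofReal]
  change b i * _ + t * a j * _ = t * a j * b i / (t * a j + b i) * Complex.normSq (W i j)
  field_simp

theorem posDef_convexCombination {A₁ A₂ : Matrix (Fin n) (Fin n) ℂ} (hA₁ : A₁.PosDef)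
    (hA₂ : A₂.PosDef) {c : ℝ} (hc0 : 0 ≤ c) (hc1 : c ≤ 1) :
    (c • A₁ + (1 - c) • A₂).PosDef := by
  rcases hc0.eq_or_lt with rfl | hc
  · simpa using hA₂
  · exact (hA₁.smul hc).add_posSemidef (hA₂.posSemidef.smul (sub_nonneg.2 hc1))

theorem parallelForm_concave {A₁ A₂ B₁ B₂ : Matrix (Fin n) (Fin n) ℂ} (hA₁ : A₁.PosDef)
    (hA₂ : A₂.PosDef) (hB₁ : B₁.PosDef) (hB₂ : B₂.PosDef) {c : ℝ} (hc0 : 0 ≤ c) (hc1 : c ≤ 1)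
    (X : Matrix (Fin n) (Fin n) ℂ) {t : ℝ} (ht : 0 < t) :
    c * parallelForm hA₁.isHermitian hB₁.isHermitian X t +
        (1 - c) * parallelForm hA₂.isHermitian hB₂.isHermitian X t ≤
      parallelForm (posDef_convexCombination hA₁ hA₂ hc0 hc1).isHermitian
        (posDef_convexCombination hB₁ hB₂ hc0 hc1).isHermitian X t := by
  obtain ⟨Y, Z, rfl, h⟩ := exists_splitForm_eq_parallelForm
    (posDef_convexCombination hA₁ hA₂ hc0 hc1) (posDef_convexCombination hB₁ hB₂ hc0 hc1) X ht
  rw [← h, splitForm_convexCombination]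
  have hc1' := sub_nonneg.2 hc1
  gcongr
  · exact parallelForm_le_splitForm hA₁ hB₁ Y Z ht
  · exact parallelForm_le_splitForm hA₂ hB₂ Y Z ht

theorem mul_rpowIntegrand_div {p t a b : ℝ} (hp : p ∈ Ioo 0 1) (ht : 0 < t) (ha : 0 < a)
    (hb : 0 < b) :
    a * rpowIntegrand₀₁ p t (b / a) = t ^ (p - 1) / t * (t * a * b / (t * a + b)) := by
  rw [rpowIntegrand₀₁_eq_pow_div hp ht.le (by positivity)]
  field_simp

/-- The trace function is an integral of parallel sums, with a measure depending only on `p`. -/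
theorem exists_measure_trace_eq_integral_parallelForm {p : ℝ} (hp : p ∈ Ioo 0 1) :
    ∃ μ : Measure ℝ, ∀ (A B : Matrix (Fin n) (Fin n) ℂ) (hA : A.PosDef) (hB : B.PosDef)
      (X : Matrix (Fin n) (Fin n) ℂ),
      IntegrableOn (fun t => t ^ (p - 1) / t *
        parallelForm hA.isHermitian hB.isHermitian X t) (Ioi 0) μ ∧
      ((matrixRpow A (1 - p) * Xᴴ * matrixRpow B p * X).trace).re =
        ∫ t in Ioi 0, t ^ (p - 1) / t *
          parallelForm hA.isHermitian hB.isHermitian X t ∂μ := by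
  obtain ⟨μ, hμ⟩ := exists_measure_rpow_eq_integral_rpowIntegrand₀₁ hp
  refine ⟨μ, fun A B hA hB X => ?_⟩
  set a := hA.isHermitian.eigenvalues
  set b := hB.isHermitian.eigenvalues
  set W := eigenbasisChange hA.isHermitian hB.isHermitian X
  have ha : ∀ j, 0 < a j := hA.eigenvalues_pos
  have hb : ∀ i, 0 < b i := hB.eigenvalues_pos
  have hint : ∀ i j, IntegrableOn (fun t => a j * rpowIntegrand₀₁ p t (b i / a j) *
      Complex.normSq (W i j)) (Ioi 0) μ := fun i j =>
    ((hμ (b i / a j) (div_pos (hb i) (ha j)).le).1.const_mul _).mul_const _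
  have heq : EqOn (fun t => t ^ (p - 1) / t * parallelForm hA.isHermitian hB.isHermitian X t)
      (fun t => ∑ i, ∑ j, a j * rpowIntegrand₀₁ p t (b i / a j) * Complex.normSq (W i j))
      (Ioi 0) := by
    intro t ht
    simp only [parallelForm, Finset.mul_sum]
    refine Finset.sum_congr rfl fun i _ => Finset.sum_congr rfl fun j _ => ?_
    rw [mul_rpowIntegrand_div hp ht (ha j) (hb i)]
    exact (mul_assoc _ _ _).symm
  have hsum : ∀ i, IntegrableOn (fun t => ∑ j, a j * rpowIntegrand₀₁ p t (b i / a j) *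
      Complex.normSq (W i j)) (Ioi 0) μ := fun i => integrable_finsetSum _ fun j _ => hint i j
  refine ⟨IntegrableOn.congr_fun (integrable_finsetSum _ fun i _ => hsum i) heq.symm
    measurableSet_Ioi, ?_⟩
  rw [setIntegral_congr_fun measurableSet_Ioi heq, integral_finsetSum _ fun i _ => hsum i,
    matrixRpow, matrixRpow, re_trace_cfc_mul hA.isHermitian hB.isHermitian]
  refine Finset.sum_congr rfl fun i _ => ?_
  rw [integral_finsetSum _ fun j _ => hint i j]
  refine Finset.sum_congr rfl fun j _ => ?_
  rw [integral_mul_const, integral_const_mul, ← (hμ _ (div_pos (hb i) (ha j)).le).2,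
    div_rpow (hb i).le (ha j).le, rpow_sub (ha j), rpow_one]
  congr 1
  change a j / a j ^ p * b i ^ p = _
  ring

/-- Lieb's concavity theorem for exponents of sum one. -/
theorem concavity_of_add_eq_one {p : ℝ} (hp : p ∈ Ioo 0 1) (X : Matrix (Fin n) (Fin n) ℂ)
    {A₁ A₂ B₁ B₂ : Matrix (Fin n) (Fin n) ℂ} (hA₁ : A₁.PosDef) (hA₂ : A₂.PosDef)
    (hB₁ : B₁.PosDef) (hB₂ : B₂.PosDef) {c : ℝ} (hc0 : 0 ≤ c) (hc1 : c ≤ 1) :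
    c * ((matrixRpow A₁ (1 - p) * Xᴴ * matrixRpow B₁ p * X).trace).re +
        (1 - c) * ((matrixRpow A₂ (1 - p) * Xᴴ * matrixRpow B₂ p * X).trace).re ≤
      ((matrixRpow (c • A₁ + (1 - c) • A₂) (1 - p) * Xᴴ *
        matrixRpow (c • B₁ + (1 - c) • B₂) p * X).trace).re := by
  obtain ⟨μ, hμ⟩ := exists_measure_trace_eq_integral_parallelForm (n := n) hp
  obtain ⟨i₁, e₁⟩ := hμ A₁ B₁ hA₁ hB₁ X
  obtain ⟨i₂, e₂⟩ := hμ A₂ B₂ hA₂ hB₂ X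
  obtain ⟨i, e⟩ := hμ _ _ (posDef_convexCombination hA₁ hA₂ hc0 hc1)
    (posDef_convexCombination hB₁ hB₂ hc0 hc1) X
  rw [e₁, e₂, e, ← integral_const_mul, ← integral_const_mul,
    ← integral_add (i₁.const_mul _) (i₂.const_mul _)]
  refine setIntegral_mono_on ((i₁.const_mul _).add (i₂.const_mul _)) i measurableSet_Ioi
    fun t ht => ?_
  have ht' : 0 < t := ht
  have h := mul_le_mul_of_nonneg_left (parallelForm_concave hA₁ hA₂ hB₁ hB₂ hc0 hc1 X ht')
    (show 0 ≤ t ^ (p - 1) / t by positivity)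
  linarith

theorem matrixRpow_eq_rpow {A : Matrix (Fin n) (Fin n) ℂ} (hA : A.PosSemidef) (s : ℝ) :
    matrixRpow A s = A ^ s :=
  (CFC.rpow_eq_cfc_real hA.nonneg).symm

theorem posDef_rpow {A : Matrix (Fin n) (Fin n) ℂ} (hA : A.PosDef) (s : ℝ) :
    (A ^ s).PosDef :=
  isStrictlyPositive_iff_posDef.1 (IsStrictlyPositive.rpow A s hA.isStrictlyPositive)

/-- The trace pairing is monotone in both positive arguments. -/
theorem re_trace_mono {P P' Q Q' : Matrix (Fin n) (Fin n) ℂ} (hP : P ≤ P') (hQ : Q ≤ Q')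
    (hP' : 0 ≤ P') (hQ₀ : 0 ≤ Q) (X : Matrix (Fin n) (Fin n) ℂ) :
    ((P * Xᴴ * Q * X).trace).re ≤ ((P' * Xᴴ * Q' * X).trace).re := by
  have key : ∀ {R S : Matrix (Fin n) (Fin n) ℂ}, 0 ≤ R → 0 ≤ S →
      0 ≤ ((R * Xᴴ * S * X).trace).re := by
    intro R S hR hS
    have hR' := hR.isSelfAdjoint.isHermitian
    have hS' := hS.isSelfAdjoint.isHermitian
    have h := re_trace_cfc_mul hR' hS' X (fun x => x) (fun x => x)
    rw [cfc_id' ℝ R hR.isSelfAdjoint, cfc_id' ℝ S hS.isSelfAdjoint] at h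
    rw [h]
    refine Finset.sum_nonneg fun i _ => Finset.sum_nonneg fun j _ => ?_
    exact mul_nonneg (mul_nonneg ((nonneg_iff_posSemidef.1 hR).eigenvalues_nonneg j)
      ((nonneg_iff_posSemidef.1 hS).eigenvalues_nonneg i)) (Complex.normSq_nonneg _)
  have h₁ := key (sub_nonneg.2 hP) hQ₀
  have h₂ := key hP' (sub_nonneg.2 hQ)
  simp only [sub_mul, mul_sub, trace_sub, Complex.sub_re] at h₁ h₂
  linarith

end Lieb

open Lieb in
/-- Lieb's theorem for `p + q ≤ 1`: for `p, q > 0` with `p + q ≤ 1` and a fixed matrix `X`,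
the function `(A, B) ↦ Trace (A^q X* B^p X)` is jointly concave on pairs of positive
definite matrices. -/
theorem lieb_concavity_of_add_le_one {n : ℕ} (p q : ℝ) (hp : 0 < p) (hq : 0 < q)
    (hpq : p + q ≤ 1) (X : Matrix (Fin n) (Fin n) ℂ)
    (A₁ A₂ B₁ B₂ : Matrix (Fin n) (Fin n) ℂ)
    (hA₁ : A₁.PosDef) (hA₂ : A₂.PosDef) (hB₁ : B₁.PosDef) (hB₂ : B₂.PosDef)
    (c : ℝ) (hc0 : 0 ≤ c) (hc1 : c ≤ 1) :
    ((matrixRpow (c • A₁ + (1 - c) • A₂) q * Xᴴ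
        * matrixRpow (c • B₁ + (1 - c) • B₂) p * X).trace).re
      ≥ c * ((matrixRpow A₁ q * Xᴴ * matrixRpow B₁ p * X).trace).re
        + (1 - c) * ((matrixRpow A₂ q * Xᴴ * matrixRpow B₂ p * X).trace).re := by
  have hs : 0 < p + q := by positivity
  have hr : p / (p + q) ∈ Ioo (0 : ℝ) 1 := ⟨by positivity, by rw [div_lt_one hs]; linarith⟩
  have hp' : (p + q) * (p / (p + q)) = p := by field_simp
  have hq' : (p + q) * (1 - p / (p + q)) = q := by field_simp; ring
  have hrp : p / (p + q) ∈ Icc (0 : ℝ) 1 := ⟨hr.1.le, hr.2.le⟩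
  have hrq : 1 - p / (p + q) ∈ Icc (0 : ℝ) 1 := ⟨by linarith [hr.2], by linarith [hr.1]⟩
  have rpow_split : ∀ {A : Matrix (Fin n) (Fin n) ℂ}, A.PosDef →
      matrixRpow A q = (A ^ (p + q)) ^ (1 - p / (p + q)) ∧
      matrixRpow A p = (A ^ (p + q)) ^ (p / (p + q)) := by
    intro A hA
    rw [matrixRpow_eq_rpow hA.posSemidef, matrixRpow_eq_rpow hA.posSemidef,
      CFC.rpow_rpow_of_exponent_nonneg A _ _ hs.le hrq.1 hA.posSemidef.nonneg,
      CFC.rpow_rpow_of_exponent_nonneg A _ _ hs.le hrp.1 hA.posSemidef.nonneg, hp', hq']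
    exact ⟨rfl, rfl⟩
  have rpow_concave : ∀ {A A' : Matrix (Fin n) (Fin n) ℂ}, A.PosDef → A'.PosDef →
      c • A ^ (p + q) + (1 - c) • A' ^ (p + q) ≤ (c • A + (1 - c) • A') ^ (p + q) :=
    fun hA hA' => (CFC.concaveOn_rpow ⟨hs.le, hpq⟩).2 hA.posSemidef.nonneg
      hA'.posSemidef.nonneg hc0 (sub_nonneg.2 hc1) (by ring)
  have hA := posDef_convexCombination hA₁ hA₂ hc0 hc1
  have hB := posDef_convexCombination hB₁ hB₂ hc0 hc1
  have h := concavity_of_add_eq_one hr X (posDef_rpow hA₁ (p + q)) (posDef_rpow hA₂ (p + q))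
    (posDef_rpow hB₁ (p + q)) (posDef_rpow hB₂ (p + q)) hc0 hc1
  rw [matrixRpow_eq_rpow (posDef_rpow hA₁ _).posSemidef,
    matrixRpow_eq_rpow (posDef_rpow hA₂ _).posSemidef,
    matrixRpow_eq_rpow (posDef_rpow hB₁ _).posSemidef,
    matrixRpow_eq_rpow (posDef_rpow hB₂ _).posSemidef,
    matrixRpow_eq_rpow (posDef_convexCombination (posDef_rpow hA₁ _) (posDef_rpow hA₂ _)
      hc0 hc1).posSemidef,
    matrixRpow_eq_rpow (posDef_convexCombination (posDef_rpow hB₁ _) (posDef_rpow hB₂ _)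
      hc0 hc1).posSemidef] at h
  rw [(rpow_split hA).1, (rpow_split hB).2, (rpow_split hA₁).1, (rpow_split hA₂).1,
    (rpow_split hB₁).2, (rpow_split hB₂).2]
  exact h.trans (re_trace_mono (CFC.rpow_le_rpow hrq (rpow_concave hA₁ hA₂))
    (CFC.rpow_le_rpow hrp (rpow_concave hB₁ hB₂)) CFC.rpow_nonneg CFC.rpow_nonneg X)
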